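/- Let i ≥ 2 be even and let j be a positive divisor of i. Suppose the set of nonzero totally singular vectors of 𝔽₂^i × 𝔽₂^i (with respect to Q(a,b) = a·b) can be partitioned into 2^{i−1} + 1 totally singular i-dimensional subspaces. Then there exist (2^{i−1} + 1)(2^i − 1)/(2^j − 1) totally singular j-dimensional subspaces of 𝔽₂^i × 𝔽₂^i that pairwise intersect only in the zero subspace, and consequently there exist 2^j (2^{i−1} + 1)(2^i − 1)/(2^j − 1) pairwise distinct subspaces of ℝ^{2^i}, each of dimension 2^{i−j}, such that any two distinct members P, Q satisfy ½‖Π_P − Π_Q‖² ≥ 2^{i−j} − 2^{i−2j}. -/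

import Mathlib

open Matrix BigOperators

/-- The squared Frobenius norm of a real matrix. -/
def frobSq {n : Type*} [Fintype n] (A : Matrix n n ℝ) : ℝ :=
  ∑ u, ∑ v, (A u v) ^ 2

/-- `M` is the matrix of the orthogonal projection of `ℝ^n` onto the subspace `P`:
    a symmetric idempotent matrix whose range is `P`. -/
def IsProjOnto {n : Type*} [Fintype n] [DecidableEq n]
    (M : Matrix n n ℝ) (P : Submodule ℝ (n → ℝ)) : Prop :=
  Mᵀ = M ∧ M * M = M ∧ LinearMap.range (Matrix.toLin' M) = P

/-- `U i = 𝔽₂^i`. -/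
abbrev U (i : ℕ) := Fin i → ZMod 2

/-- Standard inner product on `𝔽₂^i`. -/
def dotp {i : ℕ} (a b : U i) : ZMod 2 := ∑ j, a j * b j

/-- A subspace of `𝔽₂^i × 𝔽₂^i` is totally singular for `Q(a,b) = a·b` if
    `a·b = 0` for all its elements. -/
def TotSing {i : ℕ} (S : Submodule (ZMod 2) (U i × U i)) : Prop :=
  ∀ p ∈ S, dotp p.1 p.2 = 0

theorem Projectivization.inf_submodule_eq_bot {K V : Type*} [DivisionRing K] [AddCommGroup V]
    [Module K V] {p q : Projectivization K V} (hpq : p ≠ q) : p.submodule ⊓ q.submodule = ⊥ := by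
  rw [Submodule.eq_bot_iff]
  rintro v ⟨hp, hq⟩
  by_contra hv
  refine hpq ?_
  have key : ∀ r : Projectivization K V, v ∈ r.submodule → r = Projectivization.mk K v hv := by
    intro r hr
    rw [← r.mk_rep, Projectivization.mk_eq_mk_iff']
    rw [Projectivization.submodule_eq, Submodule.mem_span_singleton] at hr
    obtain ⟨c, hc⟩ := hr
    have hc0 : c ≠ 0 := by
      rintro rfl
      exact hv (by simpa using hc.symm)
    exact ⟨c⁻¹, by rw [← hc, smul_smul, inv_mul_cancel₀ hc0, one_smul]⟩
  rw [key p hp, key q hq]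

/-- A vector space of dimension `j * m` over `ZMod 2` has a spread of `j`-dimensional subspaces. -/
theorem exists_spread {V : Type*} [AddCommGroup V] [Module (ZMod 2) V] {j m : ℕ} (hj : j ≠ 0)
    (hm : m ≠ 0) (hV : Module.finrank (ZMod 2) V = j * m) :
    ∃ T : Finset (Submodule (ZMod 2) V), T.card * (2 ^ j - 1) = 2 ^ (j * m) - 1 ∧
      (∀ W ∈ T, Module.finrank (ZMod 2) W = j) ∧
      ∀ W ∈ T, ∀ W' ∈ T, W ≠ W' → W ⊓ W' = ⊥ := by
  classical
  let K := GaloisField 2 j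
  have : Module.Finite (ZMod 2) V :=
    Module.finite_of_finrank_pos (by rw [hV]; positivity)
  have hK : Module.finrank (ZMod 2) K = j := GaloisField.finrank 2 hj
  have hKm : Module.finrank (ZMod 2) (Fin m → K) = j * m := by
    rw [Module.finrank_pi_fintype]; simp [hK, mul_comm]
  let φ : (Fin m → K) ≃ₗ[ZMod 2] V := LinearEquiv.ofFinrankEq _ _ (hKm.trans hV.symm)
  let L : Projectivization K (Fin m → K) → Submodule (ZMod 2) V := fun p =>
    (p.submodule.restrictScalars (ZMod 2)).map φ.toLinearMap
  have hrank : ∀ p, Module.finrank (ZMod 2) (L p) = j := by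
    intro p
    have h1 : Module.finrank (ZMod 2) p.submodule = j := by
      rw [← Module.finrank_mul_finrank (ZMod 2) K p.submodule, p.finrank_submodule, hK, mul_one]
    rw [LinearEquiv.finrank_map_eq φ]
    exact h1
  have hinf : ∀ p q, p ≠ q → L p ⊓ L q = ⊥ := by
    intro p q hpq
    have h := Projectivization.inf_submodule_eq_bot hpq
    rw [← Submodule.map_inf _ φ.injective, ← Submodule.restrictScalars_inf, h]
    simp
  have hinj : Function.Injective L := by
    intro p q hL
    by_contra hpq
    have h := hinf p q hpq
    rw [hL, inf_idem] at h
    have h2 := hrank q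
    rw [h, finrank_bot] at h2
    exact hj h2.symm
  have := Fintype.ofFinite (Projectivization K (Fin m → K))
  refine ⟨Finset.univ.map ⟨L, hinj⟩, ?_, ?_, ?_⟩
  · have h := Projectivization.card K (Fin m → K)
    have hc : Nat.card K = 2 ^ j := GaloisField.card 2 j hj
    rw [Finset.card_map, Finset.card_univ, ← Nat.card_eq_fintype_card, pow_mul, ← hc]
    simpa [Nat.card_fun] using h.symm
  · simp [hrank]
  · simp only [Finset.mem_map, Finset.mem_univ, true_and, Function.Embedding.coeFn_mk]
    rintro _ ⟨p, rfl⟩ _ ⟨q, rfl⟩ h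
    exact hinf p q fun e => h (by rw [e])

/-- An alternating bilinear form is the antisymmetrization of a bilinear form. -/
theorem LinearMap.BilinForm.IsAlt.exists_eq_sub_flip {K V : Type*} [Field K] [AddCommGroup V]
    [Module K V] [FiniteDimensional K V] {B : LinearMap.BilinForm K V} (hB : B.IsAlt) :
    ∃ C : LinearMap.BilinForm K V, ∀ x y, B x y = C x y - C y x := by
  let b := Module.finBasis K V
  let C : LinearMap.BilinForm K V :=
    Matrix.toBilin b (Matrix.of fun k l => if k < l then B (b k) (b l) else 0)
  have hC : ∀ k l, C (b k) (b l) = if k < l then B (b k) (b l) else 0 := by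
    intro k l
    rw [← LinearMap.BilinForm.toMatrix_apply b C, LinearMap.BilinForm.toMatrix_toBilin]
    rfl
  have h : B = C - C.flip := by
    refine LinearMap.BilinForm.ext_basis b fun k l => ?_
    have hflip : C.flip (b k) (b l) = C (b l) (b k) := rfl
    rw [LinearMap.sub_apply, LinearMap.sub_apply, hflip, hC, hC]
    rcases lt_trichotomy k l with hkl | rfl | hkl
    · simp [hkl, hkl.not_gt]
    · simpa using hB (b k)
    · simp [hkl, hkl.not_gt, LinearMap.BilinForm.IsAlt.neg_eq hB]
  exact ⟨C, fun x y => by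
    conv_lhs => rw [h]
    rfl⟩

/-- The nontrivial real character of `ZMod 2`. -/
def signChar (s : ZMod 2) : ℝ := if s = 0 then 1 else -1

@[simp] theorem signChar_zero : signChar 0 = 1 := by simp [signChar]

theorem signChar_add (s t : ZMod 2) : signChar (s + t) = signChar s * signChar t := by
  have h : ∀ s t : ZMod 2, s + t = 0 ↔ (s = 0 ↔ t = 0) := by decide
  by_cases hs : s = 0 <;> by_cases ht : t = 0 <;> simp [signChar, h, hs, ht]

theorem sum_signChar_eq_zero {G : Type*} [AddGroup G] [Fintype G] (f : G →+ ZMod 2) (hf : f ≠ 0) :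
    ∑ x, signChar (f x) = 0 := by
  obtain ⟨g, hg⟩ : ∃ g, f g ≠ 0 := by
    by_contra! h
    exact hf (AddMonoidHom.ext h)
  have h1 : signChar (f g) = -1 := by simp [signChar, hg]
  have h2 : ∑ x, signChar (f x) = ∑ x, signChar (f (g + x)) :=
    (Equiv.sum_comp (Equiv.addLeft g) fun x => signChar (f x)).symm
  simp only [map_add, signChar_add, h1, ← Finset.mul_sum] at h2
  linarith

theorem dotp_eq_dotProduct {i : ℕ} (a b : U i) : dotp a b = a ⬝ᵥ b := rfl

/-- The real Heisenberg (Pauli) matrix of `(a, b)`, sending `e_v` to `(-1)^(b·v) e_(v+a)`. -/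
def pauli {i : ℕ} (w : U i × U i) : Matrix (U i) (U i) ℝ :=
  Matrix.of fun u v => if u = v + w.1 then signChar (dotp w.2 v) else 0

theorem pauli_zero {i : ℕ} : pauli (0 : U i × U i) = 1 := by
  ext u v
  simp [pauli, Matrix.one_apply, dotp]

theorem pauli_mul {i : ℕ} (w z : U i × U i) :
    pauli w * pauli z = signChar (dotp w.2 z.1) • pauli (w + z) := by
  ext u v
  simp only [pauli, Matrix.mul_apply, Matrix.of_apply, Matrix.smul_apply, mul_ite, mul_zero,
    Finset.sum_ite_eq', Finset.mem_univ, if_true, smul_eq_mul, Prod.fst_add,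
    Prod.snd_add, dotp_eq_dotProduct, dotProduct_add, add_dotProduct, signChar_add, ite_mul,
    zero_mul]
  rw [show v + z.1 + w.1 = v + (w.1 + z.1) by abel]
  split_ifs <;> ring

theorem pauli_transpose {i : ℕ} (w : U i × U i) :
    (pauli w)ᵀ = signChar (dotp w.1 w.2) • pauli w := by
  ext u v
  have h : v = u + w.1 ↔ u = v + w.1 := by
    constructor <;> rintro rfl <;> rw [add_assoc, ZModModule.add_self, add_zero]
  simp only [pauli, Matrix.transpose_apply, Matrix.of_apply, Matrix.smul_apply, smul_eq_mul, h,
    mul_ite, mul_zero]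
  split_ifs with huv
  · rw [huv, dotp_eq_dotProduct, dotp_eq_dotProduct, dotp_eq_dotProduct, dotProduct_add,
      signChar_add, dotProduct_comm w.1, mul_comm]
  · rfl

theorem trace_pauli {i : ℕ} {w : U i × U i} (hw : w ≠ 0) : (pauli w).trace = 0 := by
  simp only [Matrix.trace, Matrix.diag_apply, pauli, Matrix.of_apply, left_eq_add]
  by_cases h1 : w.1 = 0
  · simp only [h1, if_true]
    refine sum_signChar_eq_zero
      { toFun := fun v => dotp w.2 v
        map_zero' := dotProduct_zero _
        map_add' := fun _ _ => dotProduct_add _ _ _ } fun h => hw (Prod.ext h1 ?_)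
    exact dotProduct_eq_zero _ fun v => DFunLike.congr_fun h v
  · simp [h1]

/-- `q` is a quadratic refinement on `W` of the cocycle of the Heisenberg matrices. -/
def IsRefinement {i : ℕ} (W : Submodule (ZMod 2) (U i × U i)) (q : W → ZMod 2) : Prop :=
  ∀ x y : W, q (x + y) = q x + q y + dotp x.1.2 y.1.1

theorem TotSing.exists_isRefinement {i : ℕ} {W : Submodule (ZMod 2) (U i × U i)}
    (hW : TotSing W) : ∃ q, IsRefinement W q := by
  let B : LinearMap.BilinForm (ZMod 2) W :=
    LinearMap.mk₂ (ZMod 2) (fun x y => x.1.2 ⬝ᵥ y.1.1) (by simp) (by simp) (by simp) (by simp)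
  have hB : B.IsAlt := fun x => (dotProduct_comm _ _).trans (hW x.1 x.2)
  obtain ⟨C, hC⟩ := hB.exists_eq_sub_flip
  refine ⟨fun x => C x x, fun x y => ?_⟩
  have h : dotp x.1.2 y.1.1 = C x y - C y x := hC x y
  rw [h, CharTwo.sub_eq_add]
  simp only [map_add, LinearMap.add_apply]
  ring

namespace IsRefinement

variable {i : ℕ} {W : Submodule (ZMod 2) (U i × U i)} {q q' : W → ZMod 2}

theorem map_zero (hq : IsRefinement W q) : q 0 = 0 := by
  simpa [dotp] using hq 0 0

theorem add_linearMap (hq : IsRefinement W q) (f : W →ₗ[ZMod 2] ZMod 2) :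
    IsRefinement W fun x => q x + f x := by
  intro x y
  simp only [hq x y, _root_.map_add]
  ring

/-- The difference of two refinements is additive. -/
def addHom (hq : IsRefinement W q) (hq' : IsRefinement W q') : W →+ ZMod 2 where
  toFun x := q x + q' x
  map_zero' := by rw [hq.map_zero, hq'.map_zero, add_zero]
  map_add' x y := by
    rw [hq x y, hq' x y]
    linear_combination CharTwo.add_self_eq_zero (dotp x.1.2 y.1.1)

end IsRefinement

/-- The projection onto the joint eigenspace, with signs `q`, of the Heisenberg matrices of `W`. -/
noncomputable def eigenproj {i : ℕ} (W : Submodule (ZMod 2) (U i × U i)) [Fintype W]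
    (q : W → ZMod 2) : Matrix (U i) (U i) ℝ :=
  (Nat.card W : ℝ)⁻¹ • ∑ w : W, signChar (q w) • pauli w.1

section eigenproj

variable {i : ℕ} {W W' : Submodule (ZMod 2) (U i × U i)} [Fintype W] [Fintype W']
  {q : W → ZMod 2} {q' : W' → ZMod 2}

theorem eigenproj_transpose (hW : TotSing W) : (eigenproj W q)ᵀ = eigenproj W q := by
  simp only [eigenproj, Matrix.transpose_smul, Matrix.transpose_sum, pauli_transpose]
  simp [hW _ (Subtype.prop _)]

theorem eigenproj_mul_self (hq : IsRefinement W q) :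
    eigenproj W q * eigenproj W q = eigenproj W q := by
  have hW : (Nat.card W : ℝ) ≠ 0 := Nat.cast_ne_zero.2 Nat.card_pos.ne'
  have h : ∀ x : W, ∑ y : W, (signChar (q x) * signChar (q y)) • (pauli x.1 * pauli y.1) =
      ∑ w : W, signChar (q w) • pauli w.1 := by
    intro x
    rw [← Equiv.sum_comp (Equiv.addLeft x) fun w : W => signChar (q w) • pauli w.1]
    refine Finset.sum_congr rfl fun y _ => ?_
    rw [Equiv.coe_addLeft, hq, pauli_mul, smul_smul, signChar_add, signChar_add]
    rfl
  simp only [eigenproj, smul_mul_smul_comm, Finset.sum_mul_sum, h, Finset.sum_const,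
    Finset.card_univ, ← Nat.card_eq_fintype_card]
  rw [← Nat.cast_smul_eq_nsmul ℝ, smul_smul]
  congr 1
  field_simp

theorem trace_eigenproj (hq : IsRefinement W q) :
    (eigenproj W q).trace = 2 ^ i / Nat.card W := by
  rw [eigenproj, Matrix.trace_smul, Matrix.trace_sum, Finset.sum_eq_single 0]
  · rw [hq.map_zero, signChar_zero, one_smul, ZeroMemClass.coe_zero, pauli_zero, Matrix.trace_one]
    simp [div_eq_inv_mul]
  · intro w _ hw
    rw [Matrix.trace_smul, trace_pauli (by simpa using hw), smul_zero]
  · simp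

theorem trace_eigenproj_mul : (eigenproj W q * eigenproj W' q').trace =
    (Nat.card W : ℝ)⁻¹ * (Nat.card W' : ℝ)⁻¹ * ∑ x : W, ∑ y : W',
      signChar (q x) * signChar (q' y) * signChar (dotp x.1.2 y.1.1) *
        if x.1 = y.1 then 2 ^ i else 0 := by
  simp only [eigenproj, smul_mul_smul_comm, Finset.sum_mul_sum, Matrix.trace_smul,
    Matrix.trace_sum, smul_eq_mul, pauli_mul, mul_assoc]
  refine congrArg _ (congrArg _ (Finset.sum_congr rfl fun x _ =>
    Finset.sum_congr rfl fun y _ => ?_))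
  congr 3
  split_ifs with h
  · rw [h, show y.1 + y.1 = 0 from ZModModule.add_self _, pauli_zero, Matrix.trace_one]
    simp
  · exact trace_pauli fun h' => h (sub_eq_zero.1 ((ZModModule.sub_eq_add _ _).trans h'))

theorem trace_eigenproj_mul_of_inf_eq_bot (hq : IsRefinement W q) (hq' : IsRefinement W' q')
    (h : W ⊓ W' = ⊥) : (eigenproj W q * eigenproj W' q').trace =
      2 ^ i / Nat.card W / Nat.card W' := by
  rw [trace_eigenproj_mul, Finset.sum_eq_single 0, Finset.sum_eq_single 0]
  · simp [hq.map_zero, hq'.map_zero, dotp]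
    ring
  · intro y _ hy
    have : (0 : U i × U i) ≠ y.1 := fun h => hy (Subtype.ext h.symm)
    simp [this]
  · simp
  · intro x _ hx
    refine Finset.sum_eq_zero fun y _ => ?_
    rw [if_neg, mul_zero]
    intro hxy
    have hmem : x.1 ∈ W ⊓ W' := ⟨x.2, hxy ▸ y.2⟩
    rw [h, Submodule.mem_bot] at hmem
    exact hx (Subtype.ext hmem)
  · simp

theorem trace_eigenproj_mul_of_ne {r : W → ZMod 2} (hW : TotSing W) (hq : IsRefinement W q)
    (hr : IsRefinement W r) (hqr : q ≠ r) : (eigenproj W q * eigenproj W r).trace = 0 := by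
  have h0 : hq.addHom hr ≠ 0 := fun h => hqr <| funext fun x =>
    CharTwo.add_eq_zero.1 (DFunLike.congr_fun h x)
  have h : ∀ x : W, dotp x.1.2 x.1.1 = 0 := fun x => (dotProduct_comm _ _).trans (hW x.1 x.2)
  rw [trace_eigenproj_mul]
  simp only [← Subtype.ext_iff, mul_ite, mul_zero, Finset.sum_ite_eq, Finset.mem_univ, if_true, h,
    ← Finset.sum_mul, ← signChar_add, add_zero]
  have := sum_signChar_eq_zero _ h0
  simp only [IsRefinement.addHom, AddMonoidHom.coe_mk, ZeroHom.coe_mk] at this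
  rw [this, zero_mul, mul_zero]

end eigenproj

section IsProjOnto

variable {n : Type*} [Fintype n] [DecidableEq n] {M N : Matrix n n ℝ}
  {P Q : Submodule ℝ (n → ℝ)}

theorem IsProjOnto.eq (hM : IsProjOnto M P) (hN : IsProjOnto N P) : M = N := by
  have key : ∀ {A B : Matrix n n ℝ}, IsProjOnto A P → IsProjOnto B P → A * B = B := by
    intro A B hA hB
    apply Matrix.toLin'.injective
    refine LinearMap.ext fun x => ?_
    have hx : Matrix.toLin' B x ∈ LinearMap.range (Matrix.toLin' A) := by
      rw [hA.2.2, ← hB.2.2]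
      exact LinearMap.mem_range_self _ x
    obtain ⟨y, hy⟩ := hx
    rw [Matrix.toLin'_mul, LinearMap.comp_apply, ← hy, ← LinearMap.comp_apply,
      ← Matrix.toLin'_mul, hA.2.1]
  have h := congrArg Matrix.transpose (key hN hM)
  rw [Matrix.transpose_mul, hN.1, hM.1] at h
  rw [← h, key hM hN]

theorem IsProjOnto.finrank_eq (hM : IsProjOnto M P) : (Module.finrank ℝ P : ℝ) = M.trace := by
  have h : IsIdempotentElem (Matrix.toLin' M) := by
    rw [IsIdempotentElem, Module.End.mul_eq_comp, ← Matrix.toLin'_mul, hM.2.1]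
  rw [← Matrix.trace_toLin'_eq, (LinearMap.IsIdempotentElem.isProj_range _ h).trace, hM.2.2]

theorem IsProjOnto.half_frobSq_sub (hM : IsProjOnto M P) (hN : IsProjOnto N Q) :
    (1 / 2 : ℝ) * frobSq (M - N) = (M.trace + N.trace) / 2 - (M * N).trace := by
  have h : frobSq (M - N) = ((M - N) * (M - N)ᵀ).trace := by
    simp only [frobSq, Matrix.trace, Matrix.diag_apply, Matrix.mul_apply, Matrix.transpose_apply,
      sq]
  rw [h, Matrix.transpose_sub, hM.1, hN.1, sub_mul, mul_sub, mul_sub, hM.2.1, hN.2.1]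
  simp only [Matrix.trace_sub, Matrix.trace_mul_comm N M]
  ring

end IsProjOnto

/-- A totally singular partial spread of `j`-dimensional subspaces yields a packing. -/
theorem exists_packing_of_partial_spread {i j : ℕ} (hj : 0 < j) (hji : j ≤ i)
    (T : Finset (Submodule (ZMod 2) (U i × U i)))
    (hT : ∀ W ∈ T, TotSing W ∧ Module.finrank (ZMod 2) W = j)
    (hinf : ∀ W ∈ T, ∀ W' ∈ T, W ≠ W' → W ⊓ W' = ⊥) :
    ∃ Pk : Finset (Submodule ℝ (Fin (2 ^ i) → ℝ)),
      Pk.card = 2 ^ j * T.card ∧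
      (∀ P ∈ Pk, Module.finrank ℝ P = 2 ^ (i - j)) ∧
      (∀ P ∈ Pk, ∀ Q ∈ Pk, P ≠ Q →
        ∀ MP MQ : Matrix (Fin (2 ^ i)) (Fin (2 ^ i)) ℝ,
          IsProjOnto MP P → IsProjOnto MQ Q →
          (1 / 2 : ℝ) * frobSq (MP - MQ) ≥
            (2 : ℝ) ^ ((i : ℤ) - (j : ℤ)) - (2 : ℝ) ^ ((i : ℤ) - 2 * (j : ℤ))) := by
  have : ∀ W : T, Fintype W.1 := fun W => Fintype.ofFinite W.1
  have hsing : ∀ W : T, TotSing W.1 := fun W => (hT W.1 W.2).1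
  have hcard : ∀ W : T, Nat.card W.1 = 2 ^ j := fun W => by
    rw [Module.natCard_eq_pow_finrank (K := ZMod 2), (hT W.1 W.2).2, Nat.card_zmod]
  choose q₀ hq₀ using fun W : T => (hsing W).exists_isRefinement
  let e : U i ≃ Fin (2 ^ i) := Fintype.equivFinOfCardEq (by simp)
  let A : (Σ W : T, Module.Dual (ZMod 2) W.1) → Matrix (U i) (U i) ℝ := fun p =>
    eigenproj p.1.1 fun x => q₀ p.1 x + p.2 x
  let M : (Σ W : T, Module.Dual (ZMod 2) W.1) → Matrix (Fin (2 ^ i)) (Fin (2 ^ i)) ℝ := fun p =>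
    Matrix.reindexAlgEquiv ℝ ℝ e (A p)
  let F : (Σ W : T, Module.Dual (ZMod 2) W.1) → Submodule ℝ (Fin (2 ^ i) → ℝ) := fun p =>
    LinearMap.range (Matrix.toLin' (M p))
  have hq : ∀ p : (Σ W : T, Module.Dual (ZMod 2) W.1),
      IsRefinement p.1.1 fun x => q₀ p.1 x + p.2 x := fun p => (hq₀ p.1).add_linearMap p.2
  have hM : ∀ p, IsProjOnto (M p) (F p) := by
    intro p
    refine ⟨?_, ?_, rfl⟩
    · exact congrArg (Matrix.reindexAlgEquiv ℝ ℝ e) (eigenproj_transpose (hsing p.1))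
    · rw [← map_mul]
      exact congrArg _ (eigenproj_mul_self (hq p))
  have htr : ∀ B : Matrix (U i) (U i) ℝ, (Matrix.reindexAlgEquiv ℝ ℝ e B).trace = B.trace := by
    intro B
    exact Equiv.sum_comp e.symm fun u => B u u
  have htrM : ∀ p, (M p).trace = 2 ^ ((i : ℤ) - j) := by
    intro p
    rw [htr, trace_eigenproj (hq p), hcard p.1, zpow_sub₀ two_ne_zero]
    simp
  have hmul : ∀ p p', p ≠ p' → (M p * M p').trace ≤ 2 ^ ((i : ℤ) - 2 * j) := by
    rintro ⟨W, f⟩ ⟨W', f'⟩ hne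
    rw [← map_mul, htr]
    by_cases hWW : W = W'
    · subst hWW
      rw [trace_eigenproj_mul_of_ne (hsing W) (hq ⟨W, f⟩) (hq ⟨W, f'⟩)]
      · positivity
      · intro h
        exact hne (congrArg _ (LinearMap.ext fun x => add_left_cancel (congrFun h x)))
    · rw [trace_eigenproj_mul_of_inf_eq_bot (hq ⟨W, f⟩) (hq ⟨W', f'⟩)
        (hinf W.1 W.2 W'.1 W'.2 fun h => hWW (Subtype.ext h)), hcard W, hcard W',
        zpow_sub₀ two_ne_zero, two_mul, zpow_add₀ two_ne_zero, div_div]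
      simp
  have hdist : ∀ p p', p ≠ p' → (1 / 2 : ℝ) * frobSq (M p - M p') ≥
      2 ^ ((i : ℤ) - j) - 2 ^ ((i : ℤ) - 2 * j) := by
    intro p p' hne
    rw [(hM p).half_frobSq_sub (hM p'), htrM, htrM]
    linarith [hmul p p' hne]
  have hpos : (0 : ℝ) < 2 ^ ((i : ℤ) - j) - 2 ^ ((i : ℤ) - 2 * j) :=
    sub_pos.2 (zpow_lt_zpow_right₀ one_lt_two (by omega))
  have hinj : Function.Injective F := by
    intro p p' hF
    by_contra hne
    have h := hdist p p' hne
    have hp' := hM p'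
    rw [← hF] at hp'
    rw [(hM p).eq hp', sub_self] at h
    simp [frobSq] at h
    linarith
  have : ∀ W : T, Finite (Module.Dual (ZMod 2) W.1) := fun W =>
    Module.finite_of_finite (ZMod 2)
  have := Fintype.ofFinite (Σ W : T, Module.Dual (ZMod 2) W.1)
  refine ⟨Finset.univ.map ⟨F, hinj⟩, ?_, ?_, ?_⟩
  · have hdual : ∀ W : T, Nat.card (Module.Dual (ZMod 2) W.1) = 2 ^ j := fun W => by
      rw [Module.natCard_eq_pow_finrank (K := ZMod 2), Subspace.dual_finrank_eq, (hT W.1 W.2).2,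
        Nat.card_zmod]
    rw [Finset.card_map, Finset.card_univ, ← Nat.card_eq_fintype_card, Nat.card_sigma]
    simp [hdual, mul_comm]
  · simp only [Finset.mem_map, Finset.mem_univ, true_and, Function.Embedding.coeFn_mk]
    rintro _ ⟨p, rfl⟩
    have h := (hM p).finrank_eq
    rw [htrM, ← Nat.cast_sub hji, zpow_natCast] at h
    exact_mod_cast h
  · simp only [Finset.mem_map, Finset.mem_univ, true_and, Function.Embedding.coeFn_mk]
    rintro _ ⟨p, rfl⟩ _ ⟨p', rfl⟩ hne MP MQ hP hQ
    rw [hP.eq (hM p), hQ.eq (hM p')]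
    exact hdist p p' fun h => hne (congrArg F h)

/-- Refining each member of a singular partition by a spread gives a partial spread. -/
theorem exists_partial_spread {i j N : ℕ} (hi : i ≠ 0) (hj : j ≠ 0) (hjdvd : j ∣ i)
    (S : Fin N → Submodule (ZMod 2) (U i × U i))
    (hts : ∀ r, TotSing (S r)) (hdim : ∀ r, Module.finrank (ZMod 2) (S r) = i)
    (hinf : ∀ r s, r ≠ s → S r ⊓ S s = ⊥) :
    ∃ T : Finset (Submodule (ZMod 2) (U i × U i)),
      T.card * (2 ^ j - 1) = N * (2 ^ i - 1) ∧
      (∀ W ∈ T, TotSing W ∧ Module.finrank (ZMod 2) W = j) ∧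
      (∀ W ∈ T, ∀ W' ∈ T, W ≠ W' → W ⊓ W' = ⊥) := by
  classical
  obtain ⟨m, hm⟩ := hjdvd
  have hm0 : m ≠ 0 := by
    rintro rfl
    exact hi (by simpa using hm)
  choose T hcard hrank hT using fun r => exists_spread hj hm0 ((hdim r).trans hm)
  have hmap : ∀ r, Function.Injective (Submodule.map (S r).subtype) := fun r =>
    Submodule.map_injective_of_injective (S r).subtype_injective
  let T' : Fin N → Finset (Submodule (ZMod 2) (U i × U i)) := fun r => (T r).map ⟨_, hmap r⟩
  have hfin : ∀ r, ∀ W ∈ T' r, W ≤ S r ∧ Module.finrank (ZMod 2) W = j := by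
    intro r W hW
    obtain ⟨X, hX, rfl⟩ := Finset.mem_map.1 hW
    exact ⟨Submodule.map_subtype_le _ _,
      (Submodule.finrank_map_subtype_eq (S r) X).trans (hrank r X hX)⟩
  have hcross : ∀ r s, r ≠ s → ∀ W ∈ T' r, ∀ W' ∈ T' s, W ⊓ W' = ⊥ := by
    intro r s hrs W hW W' hW'
    rw [eq_bot_iff, ← hinf r s hrs]
    exact inf_le_inf (hfin r W hW).1 (hfin s W' hW').1
  refine ⟨Finset.univ.biUnion T', ?_, ?_, ?_⟩
  · rw [Finset.card_biUnion, Finset.sum_mul]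
    · simp only [T', Finset.card_map, hcard, ← hm]
      simp
    · intro r _ s _ hrs
      refine Finset.disjoint_left.2 fun W hW hW' => hj ?_
      have h := hcross r s hrs W hW W hW'
      rw [inf_idem] at h
      rw [← (hfin r W hW).2, h, finrank_bot]
  · intro W hW
    obtain ⟨r, -, hW⟩ := Finset.mem_biUnion.1 hW
    exact ⟨fun p hp => hts r p ((hfin r W hW).1 hp), (hfin r W hW).2⟩
  · intro W hW W' hW' hne
    obtain ⟨r, -, hW⟩ := Finset.mem_biUnion.1 hW
    obtain ⟨s, -, hW'⟩ := Finset.mem_biUnion.1 hW'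
    by_cases hrs : r = s
    · subst hrs
      obtain ⟨X, hX, rfl⟩ := Finset.mem_map.1 hW
      obtain ⟨X', hX', rfl⟩ := Finset.mem_map.1 hW'
      simp only [Function.Embedding.coeFn_mk]
      rw [← Submodule.map_inf _ (S r).subtype_injective,
        hT r X hX X' hX' fun h => hne (by rw [h]), Submodule.map_bot]
    · exact hcross r s hrs W hW W' hW'

/-- let `i ≥ 2` be even and `j ∣ i`, `j > 0`. If the nonzero totally
    singular vectors of `𝔽₂^i × 𝔽₂^i` can be partitioned into `2^{i−1} + 1`
    totally singular `i`-dimensional subspaces, then there are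
    `(2^{i−1}+1)(2^i−1)/(2^j−1)` totally singular `j`-dimensional subspaces pairwise
    meeting in `0`, and consequently a packing of `2^j(2^{i−1}+1)(2^i−1)/(2^j−1)`
    distinct `2^{i−j}`-dimensional subspaces of `ℝ^{2^i}` with pairwise squared
    chordal distance at least `2^{i−j} − 2^{i−2j}`. -/
theorem stmt18 (i j : ℕ) (hi : 2 ≤ i) (hieven : Even i) (hj : 0 < j) (hjdvd : j ∣ i)
    (S : Fin (2 ^ (i - 1) + 1) → Submodule (ZMod 2) (U i × U i))
    (hts : ∀ r, TotSing (S r))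
    (hdim : ∀ r, Module.finrank (ZMod 2) (S r) = i)
    (hpart : ∀ v : U i × U i, v ≠ 0 → dotp v.1 v.2 = 0 → ∃! r, v ∈ S r) :
    (∃ T : Finset (Submodule (ZMod 2) (U i × U i)),
      T.card * (2 ^ j - 1) = (2 ^ (i - 1) + 1) * (2 ^ i - 1) ∧
      (∀ W ∈ T, TotSing W ∧ Module.finrank (ZMod 2) W = j) ∧
      (∀ W ∈ T, ∀ W' ∈ T, W ≠ W' → W ⊓ W' = ⊥)) ∧
    (∃ Pk : Finset (Submodule ℝ (Fin (2 ^ i) → ℝ)),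
      Pk.card * (2 ^ j - 1) = 2 ^ j * ((2 ^ (i - 1) + 1) * (2 ^ i - 1)) ∧
      (∀ P ∈ Pk, Module.finrank ℝ P = 2 ^ (i - j)) ∧
      (∀ P ∈ Pk, ∀ Q ∈ Pk, P ≠ Q →
        ∀ MP MQ : Matrix (Fin (2 ^ i)) (Fin (2 ^ i)) ℝ,
          IsProjOnto MP P → IsProjOnto MQ Q →
          (1 / 2 : ℝ) * frobSq (MP - MQ) ≥
            (2 : ℝ) ^ ((i : ℤ) - (j : ℤ)) - (2 : ℝ) ^ ((i : ℤ) - 2 * (j : ℤ)))) := by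
  have hinf : ∀ r s, r ≠ s → S r ⊓ S s = ⊥ := by
    intro r s hrs
    rw [Submodule.eq_bot_iff]
    rintro v ⟨hr, hs⟩
    by_contra hv
    exact hrs ((hpart v hv (hts r v hr)).unique hr hs)
  obtain ⟨T, hcard, hT, hTinf⟩ := exists_partial_spread (by omega) hj.ne' hjdvd S hts hdim hinf
  obtain ⟨Pk, hPk, hfin, hdist⟩ :=
    exists_packing_of_partial_spread hj (Nat.le_of_dvd (by omega) hjdvd) T hT hTinf
  exact ⟨⟨T, hcard, hT, hTinf⟩, Pk, by rw [hPk, mul_assoc, hcard], hfin, hdist⟩
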